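/- arXiv:1601.00698 — 7 statements merged into one kernel-verified Lean document; each statement's English description precedes it below -/
import Mathlib

section
/- Supermartingale convergence theorem (Robbins–Siegmund): let {X_k}_{k∈ℕ} and {Y_k}_{k∈ℕ} be sequences of [0, ∞)-valued integrable random variables such that for every k, X_k and Y_k are 𝓕_k-measurable and E[X_{k+1} | 𝓕_k] + Y_k ≤ X_k almost surely. Then Σ_{k=0}^∞ Y_k < ∞ almost surely, and X_k converges almost surely to a [0, ∞)-valued random variable. -/
open MeasureTheory

/-- A nonnegative supermartingale converges almost surely. -/
theorem MeasureTheory.Supermartingale.exists_ae_tendsto_of_nonneg {Ω : Type*}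
    {m0 : MeasurableSpace Ω} {μ : Measure Ω} [IsFiniteMeasure μ] {𝒢 : Filtration ℕ m0}
    {f : ℕ → Ω → ℝ} (hf : Supermartingale f 𝒢 μ) (hpos : ∀ k ω, 0 ≤ f k ω) :
    ∀ᵐ ω ∂μ, ∃ c, Filter.Tendsto (fun k => f k ω) Filter.atTop (nhds c) := by
  have hbdd : ∀ k, eLpNorm ((-f) k) 1 μ ≤ (∫ ω, f 0 ω ∂μ).toNNReal := fun k => by
    have hle : ∫ ω, f k ω ∂μ ≤ ∫ ω, f 0 ω ∂μ := by
      simpa using hf.setIntegral_le k.zero_le MeasurableSet.univ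
    rw [Pi.neg_apply, eLpNorm_neg, eLpNorm_one_eq_lintegral_enorm,
      ← ofReal_integral_norm_eq_lintegral_enorm (hf.integrable k)]
    simp_rw [Real.norm_of_nonneg (hpos k _)]
    exact ENNReal.ofReal_le_ofReal hle
  filter_upwards [hf.neg.exists_ae_tendsto_of_bdd hbdd] with ω ⟨c, hc⟩
  exact ⟨-c, by simpa using hc.neg⟩

/-- Robbins–Siegmund supermartingale convergence theorem: if `X_k, Y_k ≥ 0` are
integrable, `𝓕_k`-measurable, and `E[X_{k+1} | 𝓕_k] + Y_k ≤ X_k` a.s. for every `k`,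
then a.s. `Σ_k Y_k < ∞` and `X_k` converges to a nonnegative limit. -/
theorem supermartingale_convergence
    {Ω : Type*} [F : MeasurableSpace Ω] (ℙ : Measure Ω) [IsProbabilityMeasure ℙ]
    (ℱ : ℕ → MeasurableSpace Ω)
    (hmono : ∀ k, ℱ k ≤ ℱ (k + 1)) (hle : ∀ k, ℱ k ≤ F)
    (X Y : ℕ → Ω → ℝ)
    (hXpos : ∀ k ω, 0 ≤ X k ω) (hYpos : ∀ k ω, 0 ≤ Y k ω)
    (hXint : ∀ k, Integrable (X k) ℙ) (hYint : ∀ k, Integrable (Y k) ℙ)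
    (hXmeas : ∀ k, StronglyMeasurable[ℱ k] (X k))
    (hYmeas : ∀ k, StronglyMeasurable[ℱ k] (Y k))
    (hsuper : ∀ k, ∀ᵐ ω ∂ℙ, (ℙ[X (k + 1)|ℱ k]) ω + Y k ω ≤ X k ω) :
    ∀ᵐ ω ∂ℙ, Summable (fun k => Y k ω) ∧
      ∃ l : ℝ, 0 ≤ l ∧ Filter.Tendsto (fun k => X k ω) Filter.atTop (nhds l) := by
  let 𝒢 : Filtration ℕ F := ⟨ℱ, monotone_nat_of_le_succ hmono, hle⟩
  have hX : Supermartingale X 𝒢 ℙ := by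
    refine supermartingale_nat hXmeas hXint fun k => ?_
    filter_upwards [hsuper k] with ω hω
    exact (le_add_of_nonneg_right (hYpos k ω)).trans hω
  have hSmeas : ∀ n k, n ≤ k + 1 → StronglyMeasurable[ℱ k] (∑ i ∈ Finset.range n, Y i) := by
    refine fun n k hnk => Finset.stronglyMeasurable_sum _ fun i hi => (hYmeas i).mono (𝒢.mono ?_)
    have := Finset.mem_range.1 hi
    omega
  have hSint : ∀ n, Integrable (∑ i ∈ Finset.range n, Y i) ℙ :=
    fun n => integrable_finsetSum' _ fun i _ => hYint i
  have hZ : Supermartingale (fun k => X k + ∑ i ∈ Finset.range k, Y i) 𝒢 ℙ := by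
    refine supermartingale_nat (fun k => (hXmeas k).add (hSmeas k k k.le_succ))
      (fun k => (hXint k).add (hSint k)) fun k => ?_
    have hS := condExp_of_stronglyMeasurable (hle k) (hSmeas (k + 1) k le_rfl) (hSint (k + 1))
    filter_upwards [hsuper k, condExp_add (hXint (k + 1)) (hSint (k + 1)) (ℱ k)] with ω hω hadd
    refine hadd.trans_le ?_
    rw [hS, Finset.sum_range_succ]
    simp only [Pi.add_apply]
    linarith
  have hZpos : ∀ k ω, 0 ≤ (X k + ∑ i ∈ Finset.range k, Y i) ω := fun k ω => by
    simpa using add_nonneg (hXpos k ω) (Finset.sum_nonneg fun i _ => hYpos i ω)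
  filter_upwards [hX.exists_ae_tendsto_of_nonneg hXpos, hZ.exists_ae_tendsto_of_nonneg hZpos]
    with ω ⟨l, hl⟩ ⟨c, hc⟩
  refine ⟨?_, l, ge_of_tendsto' hl fun k => hXpos k ω, hl⟩
  have hsum := hc.sub hl
  simp only [Pi.add_apply, Finset.sum_apply, add_sub_cancel_left] at hsum
  exact ((hasSum_iff_tendsto_nat_of_nonneg (fun i => hYpos i ω) _).2 hsum).summable
end

section
/- Coordinate Lipschitz constants and coordinate cocoercivity (Proposition B.4): let f : H → ℝ be a convex Fréchet differentiable function, fix j ∈ {1,…,m} and L_j > 0, and suppose that for every x ∈ H and every y_j ∈ H_j, f(x + ι_j y_j) ≤ f(x) + ⟨∇f(x), ι_j y_j⟩ + (L_j/2)‖y_j‖_j², where ι_j y_j denotes the element of H whose j-th coordinate is y_j and whose other coordinates are 0. Then for all x, y ∈ H, (1/L_j)‖(∇f(x))_j − (∇f(y))_j‖_j² ≤ ⟨∇f(x) − ∇f(y), x − y⟩. -/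
local notation "⟪" x ", " y "⟫" => @inner ℝ _ _ x y

/-- First-order lower bound for a convex function with a gradient. -/
theorem ConvexOn.add_inner_gradient_le {E : Type*} [NormedAddCommGroup E]
    [InnerProductSpace ℝ E] [CompleteSpace E] {f : E → ℝ} (hf : ConvexOn ℝ Set.univ f)
    {x v : E} (hx : HasGradientAt f v x) (y : E) :
    f x + inner ℝ v (y - x) ≤ f y := by
  have hline : ConvexOn ℝ Set.univ (f ∘ AffineMap.lineMap (k := ℝ) x y) := by
    simpa using hf.comp_affineMap (AffineMap.lineMap (k := ℝ) x y)
  have hderiv : HasDerivAt (f ∘ AffineMap.lineMap (k := ℝ) x y) (inner ℝ v (y - x)) 0 := by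
    have h : HasFDerivAt f (InnerProductSpace.toDual ℝ E v)
        (AffineMap.lineMap (k := ℝ) x y 0) := by
      simpa using hx.hasFDerivAt
    simpa using h.comp_hasDerivAt 0 AffineMap.hasDerivAt_lineMap
  have h : inner ℝ v (y - x) ≤ f y - f x := by
    simpa [slope_def_field] using
      hline.le_slope_of_hasDerivAt (Set.mem_univ 0) (Set.mem_univ 1) zero_lt_one hderiv
  linarith

theorem PiLp.inner_toLp_single_right {ι : Type*} [Fintype ι] [DecidableEq ι] {H : ι → Type*}
    [∀ i, NormedAddCommGroup (H i)] [∀ i, InnerProductSpace ℝ (H i)]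
    (x : PiLp 2 H) (j : ι) (u : H j) :
    inner ℝ x (WithLp.toLp 2 (Pi.single j u)) = inner ℝ (x j) u := by
  rw [PiLp.inner_apply, Finset.sum_eq_single j]
  · simp
  · intro i _ hij
    simp [hij]
  · simp

/-- Strengthened first-order lower bound for a convex function satisfying a descent inequality
in one coordinate. -/
theorem ConvexOn.add_inner_gradient_add_sq_le {ι : Type*} [Fintype ι] [DecidableEq ι]
    {H : ι → Type*} [∀ i, NormedAddCommGroup (H i)] [∀ i, InnerProductSpace ℝ (H i)]
    [CompleteSpace (PiLp 2 H)] {f : PiLp 2 H → ℝ} {g : PiLp 2 H → PiLp 2 H}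
    (hf : ConvexOn ℝ Set.univ f) (hgrad : ∀ x, HasGradientAt f (g x) x)
    {j : ι} {L : ℝ} (hL : 0 < L)
    (hcoord : ∀ (x : PiLp 2 H) (u : H j), f (x + WithLp.toLp 2 (Pi.single j u)) ≤
      f x + inner ℝ (g x) (WithLp.toLp 2 (Pi.single j u)) + L / 2 * ‖u‖ ^ 2)
    (x y : PiLp 2 H) :
    f x + inner ℝ (g x) (y - x) + L⁻¹ / 2 * ‖g x j - g y j‖ ^ 2 ≤ f y := by
  have hdescent := hcoord y (L⁻¹ • (g x j - g y j))
  have hsupport := hf.add_inner_gradient_le (hgrad x)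
    (y + WithLp.toLp 2 (Pi.single j (L⁻¹ • (g x j - g y j))))
  rw [add_sub_right_comm, inner_add_right, PiLp.inner_toLp_single_right,
    real_inner_smul_right] at hsupport
  rw [PiLp.inner_toLp_single_right, real_inner_smul_right, norm_smul, mul_pow,
    Real.norm_eq_abs, sq_abs] at hdescent
  have hsq : inner ℝ (g x j) (g x j - g y j) - inner ℝ (g y j) (g x j - g y j) =
      ‖g x j - g y j‖ ^ 2 := by
    rw [← inner_sub_left, real_inner_self_eq_norm_sq]
  have hcoeff : L / 2 * (L⁻¹ ^ 2 * ‖g x j - g y j‖ ^ 2) =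
      L⁻¹ / 2 * ‖g x j - g y j‖ ^ 2 := by
    field_simp
  have hscaled := congrArg (L⁻¹ * ·) hsq
  simp only [mul_sub] at hscaled
  linarith

/-- Coordinate Lipschitz constants and coordinate cocoercivity: if a convex
differentiable `f` on `H = H₁ × ⋯ × H_m` (with the ℓ² product inner product)
satisfies the coordinatewise descent inequality in coordinate `j` with constant
`L_j`, then `(1/L_j)‖∇f(x)_j − ∇f(y)_j‖² ≤ ⟪∇f(x) − ∇f(y), x − y⟫`. -/
theorem coordinate_cocoercivity
    (m : ℕ) (H : Fin m → Type*)
    [∀ j, NormedAddCommGroup (H j)] [∀ j, InnerProductSpace ℝ (H j)]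
    [∀ j, CompleteSpace (H j)] [CompleteSpace (PiLp 2 H)]
    (f : PiLp 2 H → ℝ) (g : PiLp 2 H → PiLp 2 H)
    (hconv : ConvexOn ℝ Set.univ f)
    (hgrad : ∀ x, HasGradientAt f (g x) x)
    (j : Fin m) (L : ℝ) (hL : 0 < L)
    (hcoord : ∀ (x : PiLp 2 H) (yj : H j),
      f (x + (WithLp.equiv 2 (∀ j, H j)).symm (Pi.single j yj)) ≤
        f x + ⟪g x, (WithLp.equiv 2 (∀ j, H j)).symm (Pi.single j yj)⟫ +
          L / 2 * ‖yj‖ ^ 2) :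
    ∀ x y : PiLp 2 H,
      L⁻¹ * ‖(WithLp.equiv 2 (∀ j, H j)) (g x) j - (WithLp.equiv 2 (∀ j, H j)) (g y) j‖ ^ 2 ≤
        ⟪g x - g y, x - y⟫ := by
  intro x y
  have hxy := hconv.add_inner_gradient_add_sq_le hgrad hL hcoord x y
  have hyx := hconv.add_inner_gradient_add_sq_le hgrad hL hcoord y x
  rw [norm_sub_rev, ← neg_sub x y, inner_neg_right] at hxy
  rw [inner_sub_left]
  change L⁻¹ * ‖g x j - g y j‖ ^ 2 ≤ _
  rw [norm_sub_rev]
  linarith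
end

section
/- Finito operator cocoercivity (Proposition C.2, Part 1): let f_1, …, f_N : H₀ → ℝ be convex differentiable functions whose gradients ∇f_i are L-Lipschitz continuous, let 0 < γ ≤ 2/L, and define S : H → H by S(x) := x − P_D(x_1 − γ∇f_1(x_1), …, x_N − γ∇f_N(x_N)). Then S is (γL/4)-cocoercive: ⟨S(x) − S(y), x − y⟩ ≥ (γL/4)‖S(x) − S(y)‖² for all x, y ∈ H. -/
local notation "⟪" x ", " y "⟫" => @inner ℝ _ _ x y

section Gradient

variable {E : Type*} [NormedAddCommGroup E] [InnerProductSpace ℝ E] [CompleteSpace E]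

theorem HasGradientAt.hasDerivAt_comp_add_smul {f : E → ℝ} {g z v : E} {t : ℝ}
    (h : HasGradientAt f g (z + t • v)) :
    HasDerivAt (fun s : ℝ => f (z + s • v)) ⟪g, v⟫ t := by
  have hl : HasDerivAt (fun s : ℝ => z + s • v) v t := by
    simpa using ((hasDerivAt_id t).smul_const v).const_add z
  simpa [Function.comp_def] using! h.hasFDerivAt.comp_hasDerivAt t hl

/-- A differentiable convex function lies above its tangent planes. -/
theorem ConvexOn.add_inner_le_of_hasGradientAt {f : E → ℝ} {g z : E}
    (hf : ConvexOn ℝ Set.univ f) (h : HasGradientAt f g z) (w : E) :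
    f z + ⟪g, w - z⟫ ≤ f w := by
  have hc : ConvexOn ℝ Set.univ (fun s : ℝ => f (z + s • (w - z))) := by
    have := hf.comp_affineMap (AffineMap.lineMap z w : ℝ →ᵃ[ℝ] E)
    simpa [Function.comp_def, AffineMap.lineMap_apply, add_comm] using this
  have hd : HasDerivAt (fun s : ℝ => f (z + s • (w - z))) ⟪g, w - z⟫ 0 :=
    HasGradientAt.hasDerivAt_comp_add_smul (by simpa using h)
  have := hc.le_slope_of_hasDerivAt (Set.mem_univ 0) (Set.mem_univ 1) one_pos hd
  simp [slope_def_field] at this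
  linarith

/-- The descent lemma for functions with Lipschitz gradient. -/
theorem le_add_inner_add_of_lipschitz_gradient {f : E → ℝ} {g : E → E} {L : ℝ}
    (hgrad : ∀ z, HasGradientAt f (g z) z) (hlip : ∀ z w, ‖g z - g w‖ ≤ L * ‖z - w‖)
    (z v : E) : f (z + v) ≤ f z + ⟪g z, v⟫ + L / 2 * ‖v‖ ^ 2 := by
  have hd (t : ℝ) : HasDerivAt
      (fun s : ℝ => f (z + s • v) - s * ⟪g z, v⟫ - s ^ 2 * (L / 2 * ‖v‖ ^ 2))
      (⟪g (z + t • v), v⟫ - ⟪g z, v⟫ - t * (L * ‖v‖ ^ 2)) t := by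
    have h1 := (hgrad (z + t • v)).hasDerivAt_comp_add_smul
    have h2 := (hasDerivAt_id t).mul_const ⟪g z, v⟫
    have h3 := ((hasDerivAt_id t).pow 2).mul_const (L / 2 * ‖v‖ ^ 2)
    refine ((h1.sub h2).sub h3).congr_deriv ?_
    simp
    ring
  have ha := antitoneOn_of_deriv_nonpos (convex_Icc (0 : ℝ) 1)
    (fun t _ => (hd t).continuousAt.continuousWithinAt)
    (fun t _ => (hd t).differentiableAt.differentiableWithinAt) (fun t ht => by
      rw [interior_Icc] at ht
      rw [(hd t).deriv, ← inner_sub_left, sub_nonpos]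
      calc ⟪g (z + t • v) - g z, v⟫ ≤ ‖g (z + t • v) - g z‖ * ‖v‖ := real_inner_le_norm _ _
        _ ≤ L * ‖(z + t • v) - z‖ * ‖v‖ := by gcongr; exact hlip _ _
        _ = t * (L * ‖v‖ ^ 2) := by
          rw [add_sub_cancel_left, norm_smul, Real.norm_of_nonneg ht.1.le]; ring)
  have := ha (Set.left_mem_Icc.2 zero_le_one) (Set.right_mem_Icc.2 zero_le_one) zero_le_one
  simp at this
  linarith

/-- The Baillon–Haddad theorem: an `L`-Lipschitz gradient of a convex function is
`1 / L`-cocoercive. -/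
theorem ConvexOn.norm_sq_gradient_sub_le {f : E → ℝ} {g : E → E} {L : ℝ} (hL : 0 < L)
    (hf : ConvexOn ℝ Set.univ f) (hgrad : ∀ z, HasGradientAt f (g z) z)
    (hlip : ∀ z w, ‖g z - g w‖ ≤ L * ‖z - w‖) (x y : E) :
    ‖g x - g y‖ ^ 2 ≤ L * ⟪g x - g y, x - y⟫ := by
  have key (x y : E) : f y + ⟪g y, x - y⟫ + ‖g x - g y‖ ^ 2 / (2 * L) ≤ f x := by
    have h1 := hf.add_inner_le_of_hasGradientAt (hgrad y) (x + (-L⁻¹) • (g x - g y))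
    have h2 := le_add_inner_add_of_lipschitz_gradient hgrad hlip x ((-L⁻¹) • (g x - g y))
    have h3 : L / 2 * ‖(-L⁻¹) • (g x - g y)‖ ^ 2 = ‖g x - g y‖ ^ 2 / (2 * L) := by
      rw [norm_smul, norm_neg, norm_inv, Real.norm_of_nonneg hL.le]
      field_simp
    have h4 : ⟪g x, g x - g y⟫ - ⟪g y, g x - g y⟫ = ‖g x - g y‖ ^ 2 := by
      rw [← inner_sub_left, real_inner_self_eq_norm_sq]
    rw [add_sub_right_comm, inner_add_right, inner_smul_right] at h1
    rw [h3, inner_smul_right] at h2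
    have h5 : ‖g x - g y‖ ^ 2 / (2 * L) = L⁻¹ * ‖g x - g y‖ ^ 2 / 2 := by field_simp
    rw [h5] at h2 ⊢
    rw [← h4] at h2 ⊢
    linarith
  have h1 := key x y
  have h2 := key y x
  rw [norm_sub_rev (g y)] at h2
  have h3 : ⟪g x - g y, x - y⟫ = -⟪g y, x - y⟫ - ⟪g x, y - x⟫ := by
    rw [inner_sub_left, ← neg_sub x y, inner_neg_right]; ring
  have h4 : ‖g x - g y‖ ^ 2 = L * (2 * (‖g x - g y‖ ^ 2 / (2 * L))) := by field_simp
  rw [h4]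
  gcongr
  linarith

end Gradient

/-- If `q` satisfies the cocoercivity bound `‖q‖² ≤ 4β⟪q, d⟫`, then replacing `d` by `d - m` costs
at most the term `⟪m, d - q - m⟫`, which averages out when `m` is the mean of the `d - q`. -/
theorem inner_add_mul_norm_sq_le_inner {E : Type*} [NormedAddCommGroup E] [InnerProductSpace ℝ E]
    {β : ℝ} (hβ0 : 0 < β) (hβ : β ≤ 1 / 2) {d q : E} (hq : ‖q‖ ^ 2 ≤ 4 * β * ⟪q, d⟫) (m : E) :
    ⟪m, d - q - m⟫ + β * ‖d - m‖ ^ 2 ≤ ⟪d - m, d⟫ := by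
  have h1 : 0 ≤ ‖(2 * β) • (d - m) - q‖ ^ 2 := sq_nonneg _
  rw [norm_sub_sq_real, norm_smul, mul_pow, Real.norm_of_nonneg (by positivity),
    real_inner_smul_left] at h1
  have h2 : 0 ≤ (1 - 2 * β) * ‖d - m‖ ^ 2 := mul_nonneg (by linarith) (sq_nonneg _)
  have h3 : ⟪d - m, d⟫ = ‖d - m‖ ^ 2 + ⟪m, d - q - m⟫ + ⟪m, q⟫ := by
    simp only [norm_sub_sq_real, inner_sub_left, inner_sub_right, real_inner_self_eq_norm_sq,
      real_inner_comm m d]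
    ring
  have h4 : ⟪d - m, q⟫ = ⟪q, d⟫ - ⟪m, q⟫ := by
    rw [inner_sub_left, real_inner_comm]
  have h5 : 0 ≤ 4 * β * (β * ‖d - m‖ ^ 2 + ⟪m, q⟫) := by
    rw [h4] at h1
    linarith
  have h6 := nonneg_of_mul_nonneg_right h5 (by positivity)
  linarith

/-- Finito operator cocoercivity: with `S(x) = x − P_D(x₁ − γ∇f₁(x₁), …, x_N − γ∇f_N(x_N))`
on `H = H₀^N` (ℓ² product structure, `P_D` the projection onto the diagonal given by
averaging), `S` is `(γL/4)`-cocoercive whenever `0 < γ ≤ 2/L`. -/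
theorem finito_cocoercive
    {H0 : Type*} [NormedAddCommGroup H0] [InnerProductSpace ℝ H0] [CompleteSpace H0]
    (N : ℕ) (hN : 0 < N) (L γ : ℝ) (hL : 0 < L) (hγ0 : 0 < γ) (hγ : γ ≤ 2 / L)
    (f : Fin N → H0 → ℝ) (g : Fin N → H0 → H0)
    (hconv : ∀ i, ConvexOn ℝ Set.univ (f i))
    (hgrad : ∀ i z, HasGradientAt (f i) (g i z) z)
    (hlip : ∀ i, ∀ z w : H0, ‖g i z - g i w‖ ≤ L * ‖z - w‖)
    (S : PiLp 2 (fun _ : Fin N => H0) → PiLp 2 (fun _ : Fin N => H0))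
    (hS : ∀ (x : PiLp 2 (fun _ : Fin N => H0)) (i : Fin N),
      WithLp.equiv 2 (Fin N → H0) (S x) i =
        WithLp.equiv 2 (Fin N → H0) x i -
          (N : ℝ)⁻¹ • ∑ l, (WithLp.equiv 2 (Fin N → H0) x l -
            γ • g l (WithLp.equiv 2 (Fin N → H0) x l))) :
    ∀ x y : PiLp 2 (fun _ : Fin N => H0),
      (γ * L / 4) * ‖S x - S y‖ ^ 2 ≤ ⟪S x - S y, x - y⟫ := by
  intro x y
  have hNR : (N : ℝ) ≠ 0 := by positivity
  have hγL : γ * L ≤ 2 := (le_div_iff₀ hL).1 hγ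
  set q : Fin N → H0 := fun i => γ • (g i (x i) - g i (y i)) with hq
  set m : H0 := (N : ℝ)⁻¹ • ∑ l, (x l - y l - q l) with hm
  have hS' (i : Fin N) : (S x - S y) i = x i - y i - m := by
    have hx : S x i = x i - (N : ℝ)⁻¹ • ∑ l, (x l - γ • g l (x l)) := hS x i
    have hy : S y i = y i - (N : ℝ)⁻¹ • ∑ l, (y l - γ • g l (y l)) := hS y i
    rw [PiLp.sub_apply, hx, hy, hm, sub_sub_sub_comm, ← smul_sub, ← Finset.sum_sub_distrib]
    congr! 3 with l
    simp only [hq, smul_sub]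
    abel
  have hmean : ∑ i, ⟪m, x i - y i - q i - m⟫ = 0 := by
    rw [← inner_sum, Finset.sum_sub_distrib, Finset.sum_const, Finset.card_univ, Fintype.card_fin,
      ← Nat.cast_smul_eq_nsmul ℝ, hm, smul_inv_smul₀ hNR, sub_self, inner_zero_right]
  rw [PiLp.norm_sq_eq_of_L2, PiLp.inner_apply, Finset.mul_sum, ← zero_add (Finset.sum _ _),
    ← hmean, ← Finset.sum_add_distrib]
  refine Finset.sum_le_sum fun i _ => ?_
  rw [hS', PiLp.sub_apply]
  refine inner_add_mul_norm_sq_le_inner (by positivity) (by linarith) ?_ m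
  have := (hconv i).norm_sq_gradient_sub_le hL (hgrad i) (hlip i) (x i) (y i)
  rw [hq, norm_smul, mul_pow, Real.norm_of_nonneg hγ0.le, real_inner_smul_left]
  calc γ ^ 2 * ‖g i (x i) - g i (y i)‖ ^ 2
      ≤ γ ^ 2 * (L * ⟪g i (x i) - g i (y i), x i - y i⟫) := by gcongr
    _ = _ := by ring
end

section
/- Subgradient projector lower bound (from Proposition C.4, Part 2): let f : H → ℝ be a convex function, let g : H → H be a subgradient selection for f (i.e. f(z) ≥ f(x) + ⟨g(x), z − x⟩ for all x, z ∈ H), let C := {z ∈ H : f(z) ≤ 0}, and let ε, L > 0 satisfy f(x) ≥ ε·d_C(x) for all x ∈ H and ‖g(x)‖ ≤ L for all x ∈ H. Then for every x ∈ H with f(x) > 0 and every x* ∈ H with f(x*) ≤ 0 (so that g(x) ≠ 0 and the subgradient projector G_f(x) := x − (f(x)/‖g(x)‖²)g(x) is well defined), ⟨x − G_f(x), x − x*⟩ ≥ (ε²/L²)·d_C(x)². -/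
local notation "⟪" x ", " y "⟫" => @inner ℝ _ _ x y

/-- Subgradient projector lower bound: for the subgradient projector
`G_f(x) = x − (f(x)/‖g(x)‖²) g(x)` one has
`⟪x − G_f(x), x − x*⟫ ≥ (ε²/L²) d_C(x)²` whenever `f x > 0` and `f x* ≤ 0`. -/
theorem subgradient_projector_bound
    {H : Type*} [NormedAddCommGroup H] [InnerProductSpace ℝ H]
    (f : H → ℝ) (g : H → H)
    (hsub : ∀ x z : H, f x + ⟪g x, z - x⟫ ≤ f z)
    (ε L : ℝ) (hε : 0 < ε) (hL : 0 < L)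
    (hlow : ∀ x : H, ε * Metric.infDist x {z : H | f z ≤ 0} ≤ f x)
    (hbd : ∀ x : H, ‖g x‖ ≤ L) :
    ∀ x xstar : H, 0 < f x → f xstar ≤ 0 →
      (ε ^ 2 / L ^ 2) * Metric.infDist x {z : H | f z ≤ 0} ^ 2 ≤
        ⟪x - (x - (f x / ‖g x‖ ^ 2) • g x), x - xstar⟫ := by
  intro x xstar hx hxstar
  have hinner : f x ≤ ⟪g x, x - xstar⟫ := by
    have h := hsub x xstar
    rw [← neg_sub x xstar, inner_neg_right] at h
    linarith
  have hg : 0 < ‖g x‖ := by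
    refine norm_pos_iff.2 fun h => ?_
    rw [h, inner_zero_left] at hinner
    linarith
  rw [sub_sub_cancel, real_inner_smul_left]
  calc (ε ^ 2 / L ^ 2) * Metric.infDist x {z : H | f z ≤ 0} ^ 2
      = (ε * Metric.infDist x {z : H | f z ≤ 0}) ^ 2 / L ^ 2 := by ring
    _ ≤ f x ^ 2 / ‖g x‖ ^ 2 := by
        have hd : 0 ≤ ε * Metric.infDist x {z : H | f z ≤ 0} :=
          mul_nonneg hε.le Metric.infDist_nonneg
        gcongr
        · exact hlow x
        · exact hbd x
    _ = f x / ‖g x‖ ^ 2 * f x := by ring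
    _ ≤ f x / ‖g x‖ ^ 2 * ⟪g x, x - xstar⟫ := by gcongr
end

section
/- TropicSMART metric bounds (from the proof of Proposition C.? for Algorithm 4): let γ_1, …, γ_{M+1} > 0, let δ ∈ (0,1), and suppose γ_{M+1}·Σ_{j=1}^M γ_j‖A_j‖² ≤ δ. Then for every x = (x_1, …, x_{M+1}) ∈ H_1 × ⋯ × H_{M+1}, Σ_{j=1}^{M+1} ((1−√δ)/γ_j)‖x_j‖_j² ≤ Σ_{j=1}^{M+1} (1/γ_j)‖x_j‖_j² + 2Σ_{j=1}^M ⟨A_j x_j, x_{M+1}⟩_{M+1} ≤ Σ_{j=1}^{M+1} ((1+√δ)/γ_j)‖x_j‖_j². -/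
local notation "⟪" x ", " y "⟫" => @inner ℝ _ _ x y

/-- Weighted Young inequality for the bilinear form `⟪A x, y⟫`. -/
theorem two_mul_abs_inner_apply_le {E F : Type*} [NormedAddCommGroup E] [InnerProductSpace ℝ E]
    [NormedAddCommGroup F] [InnerProductSpace ℝ F] (A : E →L[ℝ] F) {g s : ℝ} (hg : 0 < g)
    (hs : 0 < s) (x : E) (y : F) :
    2 * |inner ℝ (A x) y| ≤ s / g * ‖x‖ ^ 2 + g * ‖A‖ ^ 2 * (‖y‖ ^ 2 / s) := by
  have h : |inner ℝ (A x) y| ≤ ‖A‖ * ‖x‖ * ‖y‖ :=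
    (abs_real_inner_le_norm _ _).trans (by gcongr; exact A.le_opNorm x)
  have hsq : s / g * ‖x‖ ^ 2 + g * ‖A‖ ^ 2 * (‖y‖ ^ 2 / s) - 2 * (‖A‖ * ‖x‖ * ‖y‖) =
      (s * ‖x‖ - g * ‖A‖ * ‖y‖) ^ 2 / (g * s) := by
    field_simp
    ring
  have hnonneg : 0 ≤ (s * ‖x‖ - g * ‖A‖ * ‖y‖) ^ 2 / (g * s) := by positivity
  linarith

/-- If `c * ∑ j, γ j * ‖A j‖ ^ 2 ≤ δ`, the cross term `2 * ∑ j, ⟪A j (x j), y⟫` is dominated by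
`√δ` times the diagonal quadratic form with weights `1 / γ j` and `1 / c`. -/
theorem abs_two_mul_sum_inner_apply_le {ι : Type*} [Fintype ι] {H : ι → Type*} {K : Type*}
    [∀ j, NormedAddCommGroup (H j)] [∀ j, InnerProductSpace ℝ (H j)]
    [NormedAddCommGroup K] [InnerProductSpace ℝ K] (A : ∀ j, H j →L[ℝ] K)
    {γ : ι → ℝ} {c δ : ℝ} (hγ : ∀ j, 0 < γ j) (hc : 0 < c) (hδ : 0 < δ)
    (hcond : c * ∑ j, γ j * ‖A j‖ ^ 2 ≤ δ) (x : ∀ j, H j) (y : K) :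
    |2 * ∑ j, inner ℝ (A j (x j)) y| ≤
      (∑ j, √δ / γ j * ‖x j‖ ^ 2) + √δ / c * ‖y‖ ^ 2 := by
  have hs : 0 < √δ := Real.sqrt_pos.mpr hδ
  calc |2 * ∑ j, inner ℝ (A j (x j)) y|
      ≤ ∑ j, 2 * |inner ℝ (A j (x j)) y| := by
        rw [abs_mul, abs_two, ← Finset.mul_sum]
        gcongr
        exact Finset.abs_sum_le_sum_abs _ _
    _ ≤ ∑ j, (√δ / γ j * ‖x j‖ ^ 2 + γ j * ‖A j‖ ^ 2 * (‖y‖ ^ 2 / √δ)) :=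
        Finset.sum_le_sum fun j _ => two_mul_abs_inner_apply_le (A j) (hγ j) hs (x j) y
    _ = (∑ j, √δ / γ j * ‖x j‖ ^ 2) + (∑ j, γ j * ‖A j‖ ^ 2) * (‖y‖ ^ 2 / √δ) := by
        rw [Finset.sum_add_distrib, Finset.sum_mul]
    _ ≤ (∑ j, √δ / γ j * ‖x j‖ ^ 2) + δ / c * (‖y‖ ^ 2 / √δ) := by
        gcongr
        rwa [le_div_iff₀' hc]
    _ = (∑ j, √δ / γ j * ‖x j‖ ^ 2) + √δ / c * ‖y‖ ^ 2 := by
        congr 1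
        nth_rewrite 1 [← Real.mul_self_sqrt hδ.le]
        field_simp

/-- TropicSMART metric bounds: if `γ_{M+1}·Σ_j γ_j‖A_j‖² ≤ δ < 1`, then the quadratic
form `Σ_j (1/γ_j)‖x_j‖² + 2Σ_j ⟪A_j x_j, x_{M+1}⟫` is squeezed between
`Σ_j ((1∓√δ)/γ_j)‖x_j‖²`.  (Here `K` plays the role of `H_{M+1}`, `xK` of `x_{M+1}`
and `γK` of `γ_{M+1}`.) -/
theorem tropicsmart_metric_bounds
    (M : ℕ) (H : Fin M → Type*) (K : Type*)
    [∀ j, NormedAddCommGroup (H j)] [∀ j, InnerProductSpace ℝ (H j)]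
    [NormedAddCommGroup K] [InnerProductSpace ℝ K]
    (A : ∀ j, H j →L[ℝ] K)
    (γ : Fin M → ℝ) (γK : ℝ) (hγ : ∀ j, 0 < γ j) (hγK : 0 < γK)
    (δ : ℝ) (hδ0 : 0 < δ) (hδ1 : δ < 1)
    (hcond : γK * ∑ j, γ j * ‖A j‖ ^ 2 ≤ δ) :
    ∀ (x : ∀ j, H j) (xK : K),
      ((∑ j, (1 - Real.sqrt δ) / γ j * ‖x j‖ ^ 2) + (1 - Real.sqrt δ) / γK * ‖xK‖ ^ 2 ≤
        (∑ j, (1 / γ j) * ‖x j‖ ^ 2) + (1 / γK) * ‖xK‖ ^ 2 + 2 * ∑ j, ⟪A j (x j), xK⟫) ∧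
      ((∑ j, (1 / γ j) * ‖x j‖ ^ 2) + (1 / γK) * ‖xK‖ ^ 2 + 2 * ∑ j, ⟪A j (x j), xK⟫ ≤
        (∑ j, (1 + Real.sqrt δ) / γ j * ‖x j‖ ^ 2) + (1 + Real.sqrt δ) / γK * ‖xK‖ ^ 2) := by
  intro x xK
  have h := abs_le.mp (abs_two_mul_sum_inner_apply_le A hγ hγK hδ0 hcond x xK)
  simp only [sub_div, add_div, sub_mul, add_mul, Finset.sum_sub_distrib, Finset.sum_add_distrib]
  constructor <;> linarith [h.1, h.2]
end

section
/- ProxSMART metric bounds (from the proof of Proposition C.? for Algorithm 5): let γ_1, …, γ_M > 0, let δ ∈ (0,1), and suppose γ_1·Σ_{j=2}^M γ_j‖A_j‖² ≤ δ. Then for every x = (x_1, …, x_M) ∈ H_1 × ⋯ × H_M, Σ_{j=1}^M ((1−√δ)/γ_j)‖x_j‖_j² ≤ Σ_{j=1}^M (1/γ_j)‖x_j‖_j² − 2Σ_{j=2}^M ⟨x_j, A_j x_1⟩_j ≤ Σ_{j=1}^M ((1+√δ)/γ_j)‖x_j‖_j². -/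
local notation "⟪" x ", " y "⟫" => @inner ℝ _ _ x y

/-- Weighted Young inequality for a sum of pairings `⟪x j, A j y⟫`. -/
theorem two_mul_abs_sum_inner_le {ι K : Type*} [Fintype ι] {H : ι → Type*}
    [NormedAddCommGroup K] [InnerProductSpace ℝ K]
    [∀ j, NormedAddCommGroup (H j)] [∀ j, InnerProductSpace ℝ (H j)]
    (A : ∀ j, K →L[ℝ] H j) {c s : ℝ} {γ : ι → ℝ} (hc : 0 < c) (hγ : ∀ j, 0 < γ j)
    (hs : 0 < s) (hcond : c * ∑ j, γ j * ‖A j‖ ^ 2 ≤ s ^ 2) (y : K) (x : ∀ j, H j) :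
    2 * |∑ j, ⟪x j, A j y⟫| ≤ s / c * ‖y‖ ^ 2 + ∑ j, s / γ j * ‖x j‖ ^ 2 := by
  have young (j : ι) : 2 * |⟪x j, A j y⟫| ≤
      γ j * ‖A j‖ ^ 2 * (‖y‖ ^ 2 / s) + s / γ j * ‖x j‖ ^ 2 := by
    have hj := hγ j
    have h : |⟪x j, A j y⟫| ≤ ‖x j‖ * (‖A j‖ * ‖y‖) :=
      (abs_real_inner_le_norm _ _).trans (by gcongr; exact (A j).le_opNorm y)
    have hsq : 0 ≤ (γ j * (‖A j‖ * ‖y‖) - s * ‖x j‖) ^ 2 / (γ j * s) := by positivity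
    have expand : (γ j * (‖A j‖ * ‖y‖) - s * ‖x j‖) ^ 2 / (γ j * s) =
        γ j * ‖A j‖ ^ 2 * (‖y‖ ^ 2 / s) + s / γ j * ‖x j‖ ^ 2
          - 2 * (‖x j‖ * (‖A j‖ * ‖y‖)) := by
      field_simp
      ring
    linarith
  have hsum : ∑ j, γ j * ‖A j‖ ^ 2 ≤ s ^ 2 / c := by
    rw [le_div_iff₀ hc]
    linarith
  calc 2 * |∑ j, ⟪x j, A j y⟫| ≤ 2 * ∑ j, |⟪x j, A j y⟫| := by
        gcongr
        exact Finset.abs_sum_le_sum_abs _ _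
    _ ≤ ∑ j, (γ j * ‖A j‖ ^ 2 * (‖y‖ ^ 2 / s) + s / γ j * ‖x j‖ ^ 2) := by
        rw [Finset.mul_sum]
        exact Finset.sum_le_sum fun j _ => young j
    _ = (∑ j, γ j * ‖A j‖ ^ 2) * (‖y‖ ^ 2 / s) + ∑ j, s / γ j * ‖x j‖ ^ 2 := by
        rw [Finset.sum_add_distrib, Finset.sum_mul]
    _ ≤ s ^ 2 / c * (‖y‖ ^ 2 / s) + ∑ j, s / γ j * ‖x j‖ ^ 2 := by gcongr
    _ = s / c * ‖y‖ ^ 2 + ∑ j, s / γ j * ‖x j‖ ^ 2 := by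
        congr 1
        field_simp

/-- ProxSMART metric bounds: if `γ₁·Σ_{j≥2} γ_j‖A_j‖² ≤ δ < 1`, then the quadratic
form `Σ_j (1/γ_j)‖x_j‖² − 2Σ_{j≥2} ⟪x_j, A_j x₁⟫` is squeezed between
`Σ_j ((1∓√δ)/γ_j)‖x_j‖²`.  (Here `K` plays the role of `H₁` and `H j`, `γ j`, `x j`
enumerate the remaining coordinates `j = 2, …, M`.) -/
theorem proxsmart_metric_bounds
    (M : ℕ) (K : Type*) (H : Fin M → Type*)
    [NormedAddCommGroup K] [InnerProductSpace ℝ K]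
    [∀ j, NormedAddCommGroup (H j)] [∀ j, InnerProductSpace ℝ (H j)]
    (A : ∀ j, K →L[ℝ] H j)
    (γ1 : ℝ) (γ : Fin M → ℝ) (hγ1 : 0 < γ1) (hγ : ∀ j, 0 < γ j)
    (δ : ℝ) (hδ0 : 0 < δ) (hδ1 : δ < 1)
    (hcond : γ1 * ∑ j, γ j * ‖A j‖ ^ 2 ≤ δ) :
    ∀ (x1 : K) (x : ∀ j, H j),
      ((1 - Real.sqrt δ) / γ1 * ‖x1‖ ^ 2 + ∑ j, (1 - Real.sqrt δ) / γ j * ‖x j‖ ^ 2 ≤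
        ((1 / γ1) * ‖x1‖ ^ 2 + ∑ j, (1 / γ j) * ‖x j‖ ^ 2) - 2 * ∑ j, ⟪x j, A j x1⟫) ∧
      (((1 / γ1) * ‖x1‖ ^ 2 + ∑ j, (1 / γ j) * ‖x j‖ ^ 2) - 2 * ∑ j, ⟪x j, A j x1⟫ ≤
        (1 + Real.sqrt δ) / γ1 * ‖x1‖ ^ 2 + ∑ j, (1 + Real.sqrt δ) / γ j * ‖x j‖ ^ 2) := by
  intro x1 x
  have h := two_mul_abs_sum_inner_le A hγ1 hγ (Real.sqrt_pos.2 hδ0)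
    (hcond.trans_eq (Real.sq_sqrt hδ0.le).symm) x1 x
  have hlow := neg_abs_le (∑ j, ⟪x j, A j x1⟫)
  have hupp := le_abs_self (∑ j, ⟪x j, A j x1⟫)
  simp only [sub_div, add_div, sub_mul, add_mul, Finset.sum_sub_distrib, Finset.sum_add_distrib]
  constructor <;> linarith
end

section
/- Linear convergence of sequences that contract within a fixed number of steps: let {a_k}_{k∈ℕ} be a sequence of nonnegative real numbers, let ρ ∈ [0,1), and let κ ∈ ℕ; suppose that for every k ∈ ℕ, a_{k+1} ≤ ρ · max{ a_h : max(k − κ, 0) ≤ h ≤ k }. Then for every k ∈ ℕ, a_k ≤ ρ^{k/(κ+1)} · a_0, where the exponent k/(κ+1) is a real number. -/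
/-- Linear convergence of sequences that contract within a fixed number of steps:
if `a (k+1) ≤ ρ · max_{max(k−κ,0) ≤ h ≤ k} a h` for all `k`, with `ρ ∈ [0,1)`,
then `a k ≤ ρ^(k/(κ+1)) · a 0`. -/
theorem linear_rate_of_delayed_contraction
    (a : ℕ → ℝ) (ha : ∀ k, 0 ≤ a k)
    (ρ : ℝ) (hρ0 : 0 ≤ ρ) (hρ1 : ρ < 1) (κ : ℕ)
    (h : ∀ k, a (k + 1) ≤
      ρ * (Finset.Icc (k - κ) k).sup' (Finset.nonempty_Icc.2 (Nat.sub_le k κ)) a) :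
    ∀ k, a k ≤ Real.rpow ρ ((k : ℝ) / ((κ : ℝ) + 1)) * a 0 := by
  intro k
  induction k using Nat.strong_induction_on with
  | _ k ih =>
    rcases k with _ | k
    · simp
    · obtain ⟨m, hm, hmax⟩ := Finset.exists_mem_eq_sup'
        (Finset.nonempty_Icc.2 (Nat.sub_le k κ)) a
      have hk := h k
      rw [hmax] at hk
      rw [Finset.mem_Icc] at hm
      rcases hρ0.eq_or_lt with rfl | hρ
      · rw [zero_mul] at hk
        exact hk.trans (mul_nonneg (Real.rpow_nonneg le_rfl _) (ha 0))
      have hκ : (0 : ℝ) < (κ : ℝ) + 1 := by positivity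
      have hle : ((k + 1 : ℕ) : ℝ) ≤ (κ : ℝ) + 1 + m := by
        have : k + 1 ≤ κ + 1 + m := by omega
        exact_mod_cast this
      have hexp : ((k + 1 : ℕ) : ℝ) / ((κ : ℝ) + 1) ≤ 1 + (m : ℝ) / ((κ : ℝ) + 1) := by
        rw [one_add_div hκ.ne']
        gcongr
      calc a (k + 1) ≤ ρ * a m := hk
        _ ≤ ρ * (ρ ^ ((m : ℝ) / ((κ : ℝ) + 1)) * a 0) :=
          mul_le_mul_of_nonneg_left (ih m (by omega)) hρ0
        _ = ρ ^ (1 + (m : ℝ) / ((κ : ℝ) + 1)) * a 0 := by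
          rw [Real.rpow_add hρ, Real.rpow_one, mul_assoc]
        _ ≤ ρ ^ (((k + 1 : ℕ) : ℝ) / ((κ : ℝ) + 1)) * a 0 :=
          mul_le_mul_of_nonneg_right
            (Real.rpow_le_rpow_of_exponent_ge hρ hρ1.le hexp) (ha 0)
end
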